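/- arXiv:1805.02698 — 7 statements merged into one kernel-verified Lean document; each statement's English description precedes it below -/
import Mathlib

section
/- The product Q·P is differentiable on (0, ∞) with (QP)′(C) = e^{F(C)}·(P(C) − Q(C)/C²) ≤ 0 for all C > 0, so the function C ↦ Q(C)·P(C) is nonincreasing on (0, ∞). -/
open MeasureTheory Real Set Filter

theorem hasDerivAt_integral_Ioi {f : ℝ → ℝ} (hf : ContinuousOn f (Ioi 0))
    (hi : ∀ C, 0 < C → IntegrableOn f (Ioi C)) {x : ℝ} (hx : 0 < x) :
    HasDerivAt (fun y => ∫ s in Ioi y, f s) (-f x) x := by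
  have hx2 : 0 < x / 2 := by positivity
  have hsub : uIcc (x / 2) x ⊆ Ioi 0 := by
    rw [uIcc_of_le (by linarith)]
    exact fun y hy => lt_of_lt_of_le hx2 hy.1
  have hd : HasDerivAt (fun y => ∫ s in (x / 2)..y, f s) (f x) x :=
    intervalIntegral.integral_hasDerivAt_right (hf.mono hsub).intervalIntegrable
      (hf.stronglyMeasurableAtFilter isOpen_Ioi x hx) (hf.continuousAt (Ioi_mem_nhds hx))
  refine (hd.const_sub (∫ s in Ioi (x / 2), f s)).congr_of_eventuallyEq ?_
  filter_upwards [Ioi_mem_nhds hx] with y hy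
  rw [← intervalIntegral.integral_interval_add_Ioi (hi _ hx2) (hi y hy)]
  ring

theorem integral_Ioi_sq_mul_le {α K C₀ : ℝ} (hα : 0 < α) (hC₀ : 0 < C₀) {u : ℝ → ℝ}
    (hbound : ∀ C, C₀ ≤ C → |u C| ≤ K * C ^ (-(3/2 : ℝ) - α))
    (hint : ∀ C, 0 < C → IntegrableOn (fun s => (u s) ^ 2 * s) (Ioi C))
    {C : ℝ} (hC : C₀ ≤ C) :
    ∫ s in Ioi C, (u s) ^ 2 * s ≤ K ^ 2 / (1 + 2 * α) * C ^ (-1 - 2 * α) := by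
  have hC0 : 0 < C := hC₀.trans_le hC
  have he : -2 - 2 * α < -1 := by linarith
  calc ∫ s in Ioi C, (u s) ^ 2 * s
      ≤ ∫ s in Ioi C, K ^ 2 * s ^ (-2 - 2 * α) := by
        refine setIntegral_mono_on (hint C hC0)
          ((integrableOn_Ioi_rpow_of_lt he hC0).const_mul _) measurableSet_Ioi fun s hs => ?_
        have hs0 : 0 < s := hC0.trans hs
        have hsq : u s ^ 2 ≤ (K * s ^ (-(3/2 : ℝ) - α)) ^ 2 := by
          rw [← sq_abs]
          exact pow_le_pow_left₀ (abs_nonneg _) (hbound s (hC.trans (le_of_lt hs))) 2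
        calc u s ^ 2 * s ≤ (K * s ^ (-(3/2 : ℝ) - α)) ^ 2 * s :=
              mul_le_mul_of_nonneg_right hsq hs0.le
          _ = K ^ 2 * (s ^ (-(3/2 : ℝ) - α) * s ^ (-(3/2 : ℝ) - α) * s ^ (1 : ℝ)) := by
              rw [rpow_one]; ring
          _ = K ^ 2 * s ^ (-2 - 2 * α) := by
              rw [← rpow_add hs0, ← rpow_add hs0]
              ring_nf
    _ = K ^ 2 / (1 + 2 * α) * C ^ (-1 - 2 * α) := by
        rw [integral_const_mul, integral_Ioi_rpow_of_lt he hC0,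
          show -2 - 2 * α + 1 = -(1 + 2 * α) by ring, show -1 - 2 * α = -(1 + 2 * α) by ring,
          neg_div_neg_eq]
        ring

theorem stmt_6
    (α : ℝ) (hα : 0 < α)
    (u : ℝ → ℝ) (hu : ContinuousOn u (Set.Ioi 0))
    (K C₀ : ℝ) (hK : 0 < K) (hC₀ : 0 < C₀)
    (hbound : ∀ C, C₀ ≤ C → |u C| ≤ K * C ^ (-(3/2 : ℝ) - α))
    (hint : ∀ C, 0 < C → MeasureTheory.IntegrableOn (fun s => (u s) ^ 2 * s) (Set.Ioi C))
    (F Q P : ℝ → ℝ)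
    (hF : ∀ C, F C = -∫ s in Set.Ioi C, (u s) ^ 2 * s)
    (hQ : ∀ C, Q C = C + ∫ s in Set.Ioi C, (1 - Real.exp (F s)))
    (hP : ∀ C, P C = ∫ s in Set.Ioi C, Real.exp (F s) / s ^ 2) :
    (∀ C, 0 < C →
        HasDerivAt (fun x => Q x * P x) (Real.exp (F C) * (P C - Q C / C ^ 2)) C ∧
        Real.exp (F C) * (P C - Q C / C ^ 2) ≤ 0) ∧
      AntitoneOn (fun x => Q x * P x) (Set.Ioi 0) := by
  have hFle : ∀ C, 0 < C → F C ≤ 0 := fun C hC => by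
    rw [hF, neg_nonpos]
    exact setIntegral_nonneg measurableSet_Ioi fun s hs =>
      mul_nonneg (sq_nonneg _) (hC.trans hs).le
  have hexp : ∀ C, 0 < C → exp (F C) ≤ 1 := fun C hC => exp_le_one_iff.2 (hFle C hC)
  have hFc : ContinuousOn F (Ioi 0) := fun C hC => by
    rw [funext hF]
    exact (hasDerivAt_integral_Ioi ((hu.pow 2).mul continuousOn_id) hint
      hC).continuousAt.neg.continuousWithinAt
  have hec : ContinuousOn (fun s => exp (F s)) (Ioi 0) := hFc.rexp
  have hQc : ContinuousOn (fun s => 1 - exp (F s)) (Ioi 0) := continuousOn_const.sub hec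
  have hPc : ContinuousOn (fun s => exp (F s) / s ^ 2) (Ioi 0) :=
    hec.div (continuousOn_id.pow 2) fun s hs => pow_ne_zero 2 (ne_of_gt hs)
  have hQi : ∀ C, 0 < C → IntegrableOn (fun s => 1 - exp (F s)) (Ioi C) := fun C hC => by
    set M := max C C₀
    have hCM : C ≤ M := le_max_left _ _
    rw [← Ioc_union_Ioi_eq_Ioi hCM]
    refine IntegrableOn.union ?_ ?_
    · exact ((hQc.mono fun s hs => hC.trans_le hs.1).integrableOn_Icc).mono_set Ioc_subset_Icc_self
    · have hM : 0 < M := hC.trans_le hCM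
      refine Integrable.mono' ((integrableOn_Ioi_rpow_of_lt
        (show -1 - 2 * α < -1 by linarith) hM).const_mul (K ^ 2 / (1 + 2 * α)))
        ((hQc.mono fun s hs => hM.trans hs).aestronglyMeasurable measurableSet_Ioi) ?_
      filter_upwards [ae_restrict_mem measurableSet_Ioi] with s hs
      have h1 := hexp s (hM.trans hs)
      have h2 := integral_Ioi_sq_mul_le hα hC₀ hbound hint ((le_max_right C C₀).trans (le_of_lt hs))
      have h3 := add_one_le_exp (F s)
      rw [norm_of_nonneg (by linarith)]
      linarith [hF s]
  have hsq : ∀ C : ℝ, 0 < C → IntegrableOn (fun s : ℝ => s ^ (-2 : ℝ)) (Ioi C) := fun C hC =>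
    integrableOn_Ioi_rpow_of_lt (by norm_num) hC
  have hle : ∀ s : ℝ, 0 < s → exp (F s) / s ^ 2 ≤ s ^ (-2 : ℝ) := fun s hs => by
    rw [rpow_neg hs.le, rpow_two, ← one_div]
    exact div_le_div_of_nonneg_right (hexp s hs) (by positivity)
  have hPi : ∀ C, 0 < C → IntegrableOn (fun s => exp (F s) / s ^ 2) (Ioi C) := fun C hC => by
    refine Integrable.mono' (hsq C hC)
      ((hPc.mono fun s hs => hC.trans hs).aestronglyMeasurable measurableSet_Ioi) ?_
    filter_upwards [ae_restrict_mem measurableSet_Ioi] with s hs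
    rw [norm_of_nonneg (by positivity)]
    exact hle s (hC.trans hs)
  have hmain : ∀ C, 0 < C →
      HasDerivAt (fun x => Q x * P x) (exp (F C) * (P C - Q C / C ^ 2)) C ∧
        exp (F C) * (P C - Q C / C ^ 2) ≤ 0 := fun C hC => by
    constructor
    · have hdQ : HasDerivAt Q (1 + -(1 - exp (F C))) C := by
        rw [funext hQ]
        exact (hasDerivAt_id C).add (hasDerivAt_integral_Ioi hQc hQi hC)
      have hdP : HasDerivAt P (-(exp (F C) / C ^ 2)) C := by
        rw [funext hP]
        exact hasDerivAt_integral_Ioi hPc hPi hC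
      refine (hdQ.mul hdP).congr_deriv ?_
      ring
    · refine mul_nonpos_of_nonneg_of_nonpos (exp_pos _).le ?_
      have hP1 : P C ≤ C / C ^ 2 := by
        rw [hP]
        refine (setIntegral_mono_on (hPi C hC) (hsq C hC) measurableSet_Ioi
          fun s hs => hle s (hC.trans hs)).trans_eq ?_
        rw [integral_Ioi_rpow_of_lt (by norm_num) hC, show (-2 : ℝ) + 1 = -1 by norm_num,
          rpow_neg_one]
        field_simp
      have hQ1 : C ≤ Q C := by
        rw [hQ, le_add_iff_nonneg_right]
        exact setIntegral_nonneg measurableSet_Ioi fun s hs => sub_nonneg.2 (hexp s (hC.trans hs))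
      have := div_le_div_of_nonneg_right hQ1 (sq_nonneg C)
      linarith
  refine ⟨hmain, antitoneOn_of_deriv_nonpos (convex_Ioi 0)
    (fun C hC => (hmain C hC).1.continuousAt.continuousWithinAt) ?_ ?_⟩
  · rw [interior_Ioi]
    exact fun C hC => (hmain C hC).1.differentiableAt.differentiableWithinAt
  · rw [interior_Ioi]
    intro C hC
    rw [(hmain C hC).1.deriv]
    exact (hmain C hC).2
end

section
/- The limit of Q(C)·P(C) as C → +∞ exists and equals 1. -/
open MeasureTheory Real Set Filter

lemma abs_setIntegral_Ioi_le_of_rpow_bound {f : ℝ → ℝ} {M b c : ℝ} (hc : 0 < c) (hb : 0 < b)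
    (hf : ∀ s, c < s → |f s| ≤ M * s ^ (-1 - b)) :
    |∫ s in Ioi c, f s| ≤ M / b * c ^ (-b) := by
  have hi : IntegrableOn (fun s : ℝ => M * s ^ (-1 - b)) (Ioi c) :=
    (integrableOn_Ioi_rpow_of_lt (by linarith) hc).const_mul M
  have h := norm_integral_le_of_norm_le (f := f) hi
    ((ae_restrict_iff' measurableSet_Ioi).2 (ae_of_all _ hf))
  rw [integral_const_mul, integral_Ioi_rpow_of_lt (by linarith) hc] at h
  calc |∫ s in Ioi c, f s| ≤ _ := h
    _ = M / b * c ^ (-b) := by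
      rw [show -1 - b + 1 = -b by ring]
      field_simp

lemma setIntegral_Ioi_inv_sq {c : ℝ} (hc : 0 < c) :
    IntegrableOn (fun s : ℝ => 1 / s ^ 2) (Ioi c) ∧ ∫ s in Ioi c, 1 / s ^ 2 = 1 / c := by
  have he : EqOn (fun s : ℝ => s ^ (-2 : ℝ)) (fun s => 1 / s ^ 2) (Ioi c) := by
    intro s hs
    have hs0 : 0 < s := hc.trans hs
    simp [rpow_neg hs0.le]
  refine ⟨(integrableOn_Ioi_rpow_of_lt (by norm_num) hc).congr_fun he measurableSet_Ioi, ?_⟩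
  rw [← setIntegral_congr_fun measurableSet_Ioi he, integral_Ioi_rpow_of_lt (by norm_num) hc]
  norm_num [rpow_neg_one]

lemma mul_setIntegral_exp_div_sq_mem_Icc {F : ℝ → ℝ} (hmono : MonotoneOn F (Ioi 0))
    (hF : ∀ s, 0 < s → F s ≤ 0) {c : ℝ} (hc : 0 < c) :
    c * ∫ s in Ioi c, exp (F s) / s ^ 2 ∈ Icc (exp (F c)) 1 := by
  obtain ⟨hi, hv⟩ := setIntegral_Ioi_inv_sq hc
  have hle : ∀ s ∈ Ioi c, exp (F s) / s ^ 2 ≤ 1 / s ^ 2 := by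
    intro s hs
    have hs0 : 0 < s := hc.trans hs
    have : F s ≤ 0 := hF s hs0
    gcongr
    exact exp_le_one_iff.2 this
  have hmeas : AEMeasurable F (volume.restrict (Ioi c)) :=
    aemeasurable_restrict_of_monotoneOn measurableSet_Ioi
      (hmono.mono (Ioi_subset_Ioi hc.le))
  have hint : IntegrableOn (fun s => exp (F s) / s ^ 2) (Ioi c) := by
    refine Integrable.mono' hi ?_ ?_
    · exact ((measurable_exp.comp_aemeasurable hmeas).div
        (by fun_prop)).aestronglyMeasurable
    · refine (ae_restrict_iff' measurableSet_Ioi).2 (ae_of_all _ fun s hs => ?_)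
      rw [norm_of_nonneg (by positivity)]
      exact hle s hs
  constructor
  · have h := setIntegral_mono_on (hi.const_mul (exp (F c))) hint measurableSet_Ioi
      fun s hs => by
        have := hmono hc (hc.trans hs) (le_of_lt hs)
        rw [mul_one_div]
        gcongr
    rw [integral_const_mul, hv] at h
    calc exp (F c) = c * (exp (F c) * (1 / c)) := by field_simp
      _ ≤ _ := by gcongr
  · have h := setIntegral_mono_on hint hi measurableSet_Ioi hle
    rw [hv] at h
    calc _ ≤ c * (1 / c) := by gcongr
      _ = 1 := by field_simp

theorem stmt_7
    (α : ℝ) (hα : 0 < α)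
    (u : ℝ → ℝ) (hu : ContinuousOn u (Set.Ioi 0))
    (K C₀ : ℝ) (hK : 0 < K) (hC₀ : 0 < C₀)
    (hbound : ∀ C, C₀ ≤ C → |u C| ≤ K * C ^ (-(3/2 : ℝ) - α))
    (hint : ∀ C, 0 < C → MeasureTheory.IntegrableOn (fun s => (u s) ^ 2 * s) (Set.Ioi C))
    (F Q P : ℝ → ℝ)
    (hF : ∀ C, F C = -∫ s in Set.Ioi C, (u s) ^ 2 * s)
    (hQ : ∀ C, Q C = C + ∫ s in Set.Ioi C, (1 - Real.exp (F s)))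
    (hP : ∀ C, P C = ∫ s in Set.Ioi C, Real.exp (F s) / s ^ 2) :
    Filter.Tendsto (fun C => Q C * P C) Filter.atTop (nhds 1) := by
  have hnonneg : ∀ c, 0 < c → ∀ s ∈ Ioi c, 0 ≤ u s ^ 2 * s := fun c hc s hs =>
    mul_nonneg (sq_nonneg _) (hc.trans hs).le
  have hF0 : ∀ c, 0 < c → F c ≤ 0 := fun c hc => by
    rw [hF, neg_nonpos]
    exact setIntegral_nonneg measurableSet_Ioi (hnonneg c hc)
  have hmono : MonotoneOn F (Ioi 0) := by
    intro a ha b _ hab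
    rw [hF, hF, neg_le_neg_iff]
    exact setIntegral_mono_set (hint a ha)
      ((ae_restrict_iff' measurableSet_Ioi).2 (ae_of_all _ (hnonneg a ha)))
      (Ioi_subset_Ioi hab).eventuallyLE
  have hsq : ∀ s, C₀ ≤ s → |u s ^ 2 * s| ≤ K ^ 2 * s ^ (-1 - (1 + 2 * α)) := by
    intro s hs
    have hs0 : 0 < s := hC₀.trans_le hs
    rw [abs_of_nonneg (by positivity), ← sq_abs]
    calc |u s| ^ 2 * s ≤ (K * s ^ (-(3/2 : ℝ) - α)) ^ 2 * s := by gcongr; exact hbound s hs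
      _ = K ^ 2 * (s ^ (-(3/2 : ℝ) - α) * s ^ (-(3/2 : ℝ) - α) * s ^ (1 : ℝ)) := by
        rw [rpow_one]; ring
      _ = _ := by
        rw [← rpow_add hs0, ← rpow_add hs0]
        ring_nf
  set M := K ^ 2 / (1 + 2 * α) with hM
  have hFbound : ∀ s, C₀ ≤ s → |F s| ≤ M * s ^ (-(1 + 2 * α)) := by
    intro s hs
    rw [hF, abs_neg]
    exact abs_setIntegral_Ioi_le_of_rpow_bound (hC₀.trans_le hs) (by positivity)
      fun t ht => hsq t (hs.trans (le_of_lt ht))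
  have hFlim : Tendsto F atTop (nhds 0) := by
    refine squeeze_zero_norm' ((eventually_ge_atTop C₀).mono hFbound) ?_
    simpa using (tendsto_rpow_neg_atTop (y := 1 + 2 * α) (by positivity)).const_mul M
  have hexp : ∀ s, C₀ ≤ s → |1 - exp (F s)| ≤ M * s ^ (-1 - 2 * α) := by
    intro s hs
    have h0 := hF0 s (hC₀.trans_le hs)
    have h1 := hFbound s hs
    rw [abs_of_nonpos h0, neg_add'] at h1
    rw [abs_of_nonneg (by linarith [exp_le_one_iff.2 h0])]
    linarith [add_one_le_exp (F s)]
  have hR : Tendsto (fun c => ∫ s in Ioi c, (1 - exp (F s))) atTop (nhds 0) := by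
    refine squeeze_zero_norm' (a := fun c => M / (2 * α) * c ^ (-(2 * α))) ?_ ?_
    · filter_upwards [eventually_ge_atTop C₀] with c hc
      exact abs_setIntegral_Ioi_le_of_rpow_bound (hC₀.trans_le hc) (by positivity)
        fun t ht => hexp t (hc.trans (le_of_lt ht))
    · simpa using (tendsto_rpow_neg_atTop (y := 2 * α) (by positivity)).const_mul (M / (2 * α))
  have hQlim : Tendsto (fun c => Q c / c) atTop (nhds 1) := by
    have h : Tendsto (fun c => 1 + (∫ s in Ioi c, (1 - exp (F s))) * c⁻¹) atTop (nhds 1) := by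
      simpa using (hR.mul tendsto_inv_atTop_zero).const_add 1
    refine h.congr' ?_
    filter_upwards [eventually_gt_atTop 0] with c hc
    rw [hQ]
    field_simp
  have hPlim : Tendsto (fun c => c * P c) atTop (nhds 1) := by
    have hmem : ∀ᶠ c in atTop, c * P c ∈ Icc (exp (F c)) 1 := by
      filter_upwards [eventually_gt_atTop 0] with c hc
      rw [hP]
      exact mul_setIntegral_exp_div_sq_mem_Icc hmono hF0 hc
    refine tendsto_of_tendsto_of_tendsto_of_le_of_le' ?_ tendsto_const_nhds
      (hmem.mono fun _ h => h.1) (hmem.mono fun _ h => h.2)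
    simpa [Function.comp_def] using (continuous_exp.tendsto 0).comp hFlim
  have h := hQlim.mul hPlim
  rw [one_mul] at h
  refine h.congr' ?_
  filter_upwards [eventually_gt_atTop 0] with c hc
  field_simp
end

section
/- For every C ∈ (0, ∞) one has Q(C)·P(C) ≥ 1. -/
open MeasureTheory Real Set Filter

/-- A bathtub inequality: among `g` with values in `[0, 1]` and `∫ (1 - g) = D` on `(C, ∞)`,
the integral of `g s / s ^ 2` is at least `1 / (C + D)`. -/
theorem inv_le_integral_div_sq {C : ℝ} (hC : 0 < C) {g : ℝ → ℝ} (h0 : ∀ s, C < s → 0 ≤ g s)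
    (h1 : ∀ s, C < s → g s ≤ 1) (hg : IntegrableOn (fun s => 1 - g s) (Ioi C)) :
    (C + ∫ s in Ioi C, (1 - g s))⁻¹ ≤ ∫ s in Ioi C, g s / s ^ 2 := by
  set D := ∫ s in Ioi C, (1 - g s) with hD
  have hD0 : 0 ≤ D := setIntegral_nonneg measurableSet_Ioi fun s hs => by linarith [h1 s hs]
  have hQ : 0 < C + D := by linarith
  have hpow : ∀ c : ℝ, 0 < c → IntegrableOn (fun s : ℝ => s ^ (-2 : ℝ)) (Ioi c) := fun c hc =>
    integrableOn_Ioi_rpow_of_lt (by norm_num) hc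
  have hpow_eq : ∀ s : ℝ, 0 < s → s ^ (-2 : ℝ) = 1 / s ^ 2 := fun s hs => by
    rw [rpow_neg hs.le, one_div]; norm_cast
  have hgm : AEStronglyMeasurable g (volume.restrict (Ioi C)) := by
    have := (aestronglyMeasurable_const (b := (1 : ℝ))).sub hg.aestronglyMeasurable
    refine this.congr (ae_of_all _ fun s => ?_)
    simp
  have hgP : IntegrableOn (fun s => g s / s ^ 2) (Ioi C) := by
    refine (hpow C hC).mono' ?_ ?_
    · have : Measurable fun s : ℝ => (s ^ 2)⁻¹ := by fun_prop
      simp only [div_eq_mul_inv]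
      exact hgm.mul this.aestronglyMeasurable
    · refine (ae_restrict_iff' measurableSet_Ioi).2 (ae_of_all _ fun s hs => ?_)
      have hs0 : 0 < s := hC.trans hs
      rw [hpow_eq s hs0, norm_of_nonneg (div_nonneg (h0 s hs) (by positivity))]
      gcongr
      exact h1 s hs
  have hi1 : IntegrableOn ((Ioi (C + D)).indicator fun s : ℝ => s ^ (-2 : ℝ)) (Ioi C) :=
    (hpow C hC).indicator measurableSet_Ioi
  have hi2 : IntegrableOn ((Ioc C (C + D)).indicator fun _ : ℝ => (1 : ℝ)) (Ioi C) :=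
    ((integrable_indicator_iff measurableSet_Ioc).2
      (integrableOn_const (by simp))).integrableOn
  have hi3 : IntegrableOn (fun s => ((C + D) ^ 2)⁻¹ *
      ((Ioc C (C + D)).indicator (fun _ : ℝ => (1 : ℝ)) s - (1 - g s))) (Ioi C) :=
    (hi2.sub hg).const_mul _
  have hint : ∫ s in Ioi C, ((Ioi (C + D)).indicator (fun s : ℝ => s ^ (-2 : ℝ)) s +
      ((C + D) ^ 2)⁻¹ * ((Ioc C (C + D)).indicator (fun _ : ℝ => (1 : ℝ)) s - (1 - g s))) =
      (C + D)⁻¹ := by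
    rw [integral_add hi1 hi3, integral_const_mul, integral_sub hi2 hg,
      setIntegral_indicator measurableSet_Ioi, setIntegral_indicator measurableSet_Ioc,
      inter_eq_self_of_subset_right (Ioi_subset_Ioi (by linarith)),
      inter_eq_self_of_subset_right Ioc_subset_Ioi_self,
      integral_Ioi_rpow_of_lt (by norm_num) hQ, ← hD]
    norm_num [hD0, rpow_neg_one]
  rw [← hint]
  refine setIntegral_mono_on (hi1.add hi3) hgP measurableSet_Ioi ?_
  intro s hs
  have hs0 : 0 < s := hC.trans hs
  rcases le_or_gt s (C + D) with h | h
  · have hle : ((C + D) ^ 2)⁻¹ ≤ (s ^ 2)⁻¹ := by gcongr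
    rw [indicator_of_notMem (by simpa using h), indicator_of_mem (show s ∈ Ioc C (C + D) from ⟨hs, h⟩), div_eq_mul_inv]
    nlinarith [mul_le_mul_of_nonneg_left hle (h0 s hs)]
  · have hle : (s ^ 2)⁻¹ ≤ ((C + D) ^ 2)⁻¹ := by gcongr
    rw [indicator_of_mem (by simpa using h), indicator_of_notMem (fun h' => h'.2.not_gt h),
      hpow_eq s hs0, one_div, div_eq_mul_inv]
    nlinarith [mul_le_mul_of_nonneg_left hle (sub_nonneg.2 (h1 s hs))]

theorem integral_sq_mul_le_of_abs_le_rpow {α K C₀ : ℝ} (hα : 0 < α) (hC₀ : 0 < C₀) {u : ℝ → ℝ}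
    (hbound : ∀ C, C₀ ≤ C → |u C| ≤ K * C ^ (-(3/2 : ℝ) - α))
    (hint : ∀ C, 0 < C → IntegrableOn (fun s => (u s) ^ 2 * s) (Ioi C)) {s : ℝ} (hs : C₀ ≤ s) :
    ∫ t in Ioi s, (u t) ^ 2 * t ≤ K ^ 2 / (1 + 2 * α) * s ^ (-1 - 2 * α) := by
  have hs0 : 0 < s := hC₀.trans_le hs
  calc ∫ t in Ioi s, (u t) ^ 2 * t
      ≤ ∫ t in Ioi s, K ^ 2 * t ^ (-2 - 2 * α) := by
        refine setIntegral_mono_on (hint s hs0)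
          ((integrableOn_Ioi_rpow_of_lt (by linarith) hs0).const_mul _) measurableSet_Ioi ?_
        intro t ht
        have ht0 : 0 < t := hs0.trans ht
        have hsq : (u t) ^ 2 ≤ (K * t ^ (-(3/2 : ℝ) - α)) ^ 2 := by
          rw [← sq_abs]
          exact pow_le_pow_left₀ (abs_nonneg _) (hbound t (hs.trans (le_of_lt ht))) 2
        have hexp : (t ^ (-(3/2 : ℝ) - α)) ^ 2 * t = t ^ (-2 - 2 * α) := by
          rw [← rpow_natCast, ← rpow_mul ht0.le, ← rpow_add_one ht0.ne']
          congr 1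
          push_cast
          ring
        calc (u t) ^ 2 * t ≤ (K * t ^ (-(3/2 : ℝ) - α)) ^ 2 * t := by gcongr
          _ = K ^ 2 * t ^ (-2 - 2 * α) := by rw [mul_pow, mul_assoc, hexp]
    _ = K ^ 2 / (1 + 2 * α) * s ^ (-1 - 2 * α) := by
        rw [integral_const_mul, integral_Ioi_rpow_of_lt (by linarith) hs0,
          show -2 - 2 * α + 1 = -1 - 2 * α by ring, show -1 - 2 * α = -(1 + 2 * α) by ring,
          neg_div_neg_eq]
        ring

theorem stmt_8
    (α : ℝ) (hα : 0 < α)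
    (u : ℝ → ℝ) (hu : ContinuousOn u (Set.Ioi 0))
    (K C₀ : ℝ) (hK : 0 < K) (hC₀ : 0 < C₀)
    (hbound : ∀ C, C₀ ≤ C → |u C| ≤ K * C ^ (-(3/2 : ℝ) - α))
    (hint : ∀ C, 0 < C → MeasureTheory.IntegrableOn (fun s => (u s) ^ 2 * s) (Set.Ioi C))
    (F Q P : ℝ → ℝ)
    (hF : ∀ C, F C = -∫ s in Set.Ioi C, (u s) ^ 2 * s)
    (hQ : ∀ C, Q C = C + ∫ s in Set.Ioi C, (1 - Real.exp (F s)))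
    (hP : ∀ C, P C = ∫ s in Set.Ioi C, Real.exp (F s) / s ^ 2) :
    ∀ C, 0 < C → 1 ≤ Q C * P C := by
  intro C hC
  have hFle : ∀ s, 0 < s → F s ≤ 0 := fun s hs => by
    rw [hF, neg_nonpos]
    exact setIntegral_nonneg measurableSet_Ioi fun t ht =>
      mul_nonneg (sq_nonneg _) (hs.trans ht).le
  have hFmono : MonotoneOn F (Ioi 0) := fun a ha b _ hab => by
    rw [hF, hF, neg_le_neg_iff]
    refine setIntegral_mono_set (hint a ha) ?_ (Ioi_subset_Ioi hab).eventuallyLE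
    exact (ae_restrict_iff' measurableSet_Ioi).2 (ae_of_all _ fun t ht =>
      mul_nonneg (sq_nonneg _) (lt_trans ha ht).le)
  have hmeas : ∀ S ⊆ Ioi (0 : ℝ), MeasurableSet S →
      AEStronglyMeasurable (fun s => 1 - exp (F s)) (volume.restrict S) := fun S hS hSm => by
    have := aemeasurable_restrict_of_monotoneOn (μ := volume) hSm (hFmono.mono hS)
    exact (aemeasurable_const.sub (measurable_exp.comp_aemeasurable this)).aestronglyMeasurable
  have hexp : ∀ s, 0 < s → exp (F s) ≤ 1 := fun s hs => exp_le_one_iff.2 (hFle s hs)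
  have hM : C ≤ max C C₀ := le_max_left _ _
  have hM0 : 0 < max C C₀ := hC.trans_le hM
  have hg : IntegrableOn (fun s => 1 - exp (F s)) (Ioi C) := by
    rw [← Ioc_union_Ioi_eq_Ioi hM]
    refine IntegrableOn.union ?_ ?_
    · refine Integrable.mono' (g := fun _ => (1 : ℝ)) (integrableOn_const (by simp))
        (hmeas _ (fun s hs => hC.trans hs.1) measurableSet_Ioc) ?_
      refine (ae_restrict_iff' measurableSet_Ioc).2 (ae_of_all _ fun s hs => ?_)
      rw [norm_of_nonneg (sub_nonneg.2 (hexp s (hC.trans hs.1)))]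
      linarith [exp_pos (F s)]
    · refine Integrable.mono' (g := fun s => K ^ 2 / (1 + 2 * α) * s ^ (-1 - 2 * α))
        ((integrableOn_Ioi_rpow_of_lt (by linarith) hM0).const_mul _)
        (hmeas _ (fun s hs => hM0.trans hs) measurableSet_Ioi) ?_
      refine (ae_restrict_iff' measurableSet_Ioi).2 (ae_of_all _ fun s hs => ?_)
      rw [norm_of_nonneg (sub_nonneg.2 (hexp s (hM0.trans hs)))]
      have := integral_sq_mul_le_of_abs_le_rpow hα hC₀ hbound hint
        ((le_max_right C C₀).trans (le_of_lt hs))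
      linarith [add_one_le_exp (F s), hF s]
  have hQ0 : 0 < Q C := by
    rw [hQ]
    have : 0 ≤ ∫ s in Ioi C, (1 - exp (F s)) := setIntegral_nonneg measurableSet_Ioi
      fun s hs => sub_nonneg.2 (hexp s (hC.trans hs))
    linarith
  have hmain := inv_le_integral_div_sq hC (fun s _ => (exp_pos (F s)).le)
    (fun s hs => hexp s (hC.trans hs)) hg
  rw [← hQ, ← hP] at hmain
  simpa [hQ0.ne'] using mul_le_mul_of_nonneg_left hmain hQ0.le
end

section
/- Suppose m ∈ ℝ, q > 0 and C* > 0 satisfy the horizon condition ∫_{C*}^∞ (Q(s) − 3m + 2q²·P(s))·e^{F(s)}/s⁴ ds = 0. Then there exists C** > C* such that Q(C**) − 3m + 2q²·P(C**) = 0. -/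
open MeasureTheory Real Set Filter

/-- If `g` is integrable on every tail `(C, ∞)` with `C > 0`, its tail integral is continuous
on `(0, ∞)`. -/
lemma continuousOn_tail_integral {g : ℝ → ℝ} (hg : ∀ C, 0 < C → IntegrableOn g (Ioi C)) :
    ContinuousOn (fun C => ∫ s in Ioi C, g s) (Ioi 0) := by
  intro x hx
  have hx : 0 < x := hx
  have h := (hg (x / 2) (by positivity)).continuousOn_Ici_primitive_Ioi
  exact (h.continuousAt (Ici_mem_nhds (by linarith))).continuousWithinAt

/-- A continuous function on `(0, ∞)` bounded by `A * s ^ p` with `p < -1` for large `s` is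
integrable on every tail. -/
lemma integrableOn_tail_of_le_rpow {g : ℝ → ℝ} (hg : ContinuousOn g (Ioi 0)) {A p B : ℝ}
    (hp : p < -1) (hB : ∀ s, B ≤ s → |g s| ≤ A * s ^ p) {C : ℝ} (hC : 0 < C) :
    IntegrableOn g (Ioi C) := by
  have hCD : C ≤ max C B := le_max_left _ _
  have hD : 0 < max C B := hC.trans_le hCD
  rw [← Ioc_union_Ioi_eq_Ioi hCD]
  refine IntegrableOn.union ?_ ?_
  · have hc : ContinuousOn g (Icc C (max C B)) := hg.mono fun x hx => hC.trans_le hx.1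
    exact hc.integrableOn_Icc.mono_set Ioc_subset_Icc_self
  · have hc : ContinuousOn g (Ioi (max C B)) := hg.mono fun x hx => hD.trans hx
    refine Integrable.mono' ((integrableOn_Ioi_rpow_of_lt hp hD).const_mul A)
      (hc.aestronglyMeasurable measurableSet_Ioi) ?_
    refine (ae_restrict_iff' measurableSet_Ioi).2 (Eventually.of_forall fun s hs => ?_)
    exact hB s ((le_max_right C B).trans (le_of_lt hs))

/-- The integral over a half-line of a strictly positive integrable function is positive. -/
lemma integral_Ioi_pos {g : ℝ → ℝ} {a : ℝ} (hg : IntegrableOn g (Ioi a))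
    (hpos : ∀ s ∈ Ioi a, 0 < g s) : 0 < ∫ s in Ioi a, g s := by
  have hnn : 0 ≤ᵐ[volume.restrict (Ioi a)] g :=
    (ae_restrict_iff' measurableSet_Ioi).2 (Eventually.of_forall fun s hs => (hpos s hs).le)
  rw [setIntegral_pos_iff_support_of_nonneg_ae hnn hg]
  rw [inter_eq_self_of_subset_right (s := Function.support g) fun s hs => (hpos s hs).ne']
  simp

/-- If a continuous function has vanishing integral against a positive weight on a half-line,
it has a zero there. -/
lemma exists_zero_of_weighted_integral_eq_zero {W w : ℝ → ℝ} {a : ℝ}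
    (hW : ContinuousOn W (Ioi a)) (hw : ∀ s ∈ Ioi a, 0 < w s)
    (hi : IntegrableOn (fun s => W s * w s) (Ioi a)) (h0 : ∫ s in Ioi a, W s * w s = 0) :
    ∃ c, a < c ∧ W c = 0 := by
  by_contra! hne
  by_cases hpos : ∀ s ∈ Ioi a, 0 < W s
  · exact (integral_Ioi_pos hi fun s hs => mul_pos (hpos s hs) (hw s hs)).ne' h0
  · push Not at hpos
    obtain ⟨b, hb, hWb⟩ := hpos
    have hneg : ∀ s ∈ Ioi a, W s < 0 := by
      intro s hs
      by_contra! hs0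
      obtain ⟨c, hc, hc0⟩ := isPreconnected_Ioi.intermediate_value hb hs hW ⟨hWb, hs0⟩
      exact hne c hc hc0
    have h := integral_Ioi_pos hi.neg fun s hs => by
      simpa using mul_neg_of_neg_of_pos (hneg s hs) (hw s hs)
    simp only [Pi.neg_apply, integral_neg, h0, neg_zero, lt_irrefl] at h

/-- The tail integral of a nonnegative function is nonnegative and decreasing. -/
lemma tail_integral_mem_Icc {g : ℝ → ℝ} {a s : ℝ} (hg : IntegrableOn g (Ioi a))
    (hnn : ∀ t ∈ Ioi a, 0 ≤ g t) (hs : a ≤ s) :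
    ∫ t in Ioi s, g t ∈ Icc 0 (∫ t in Ioi a, g t) := by
  refine ⟨setIntegral_nonneg measurableSet_Ioi fun t ht => hnn t (hs.trans_lt ht), ?_⟩
  exact setIntegral_mono_set hg
    ((ae_restrict_iff' measurableSet_Ioi).2 (Eventually.of_forall hnn))
    (Ioi_subset_Ioi hs).eventuallyLE

theorem stmt_9
    (α : ℝ) (hα : 0 < α)
    (u : ℝ → ℝ) (hu : ContinuousOn u (Set.Ioi 0))
    (K C₀ : ℝ) (hK : 0 < K) (hC₀ : 0 < C₀)
    (hbound : ∀ C, C₀ ≤ C → |u C| ≤ K * C ^ (-(3/2 : ℝ) - α))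
    (hint : ∀ C, 0 < C → MeasureTheory.IntegrableOn (fun s => (u s) ^ 2 * s) (Set.Ioi C))
    (F Q P : ℝ → ℝ)
    (hF : ∀ C, F C = -∫ s in Set.Ioi C, (u s) ^ 2 * s)
    (hQ : ∀ C, Q C = C + ∫ s in Set.Ioi C, (1 - Real.exp (F s)))
    (hP : ∀ C, P C = ∫ s in Set.Ioi C, Real.exp (F s) / s ^ 2)
    (m q Cs : ℝ) (hq : 0 < q) (hCs : 0 < Cs)
    (hhor : ∫ s in Set.Ioi Cs, (Q s - 3 * m + 2 * q ^ 2 * P s) * Real.exp (F s) / s ^ 4 = 0) :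
    ∃ Css, Cs < Css ∧ Q Css - 3 * m + 2 * q ^ 2 * P Css = 0 := by
  have hFc : ContinuousOn F (Ioi 0) :=
    ((continuousOn_tail_integral hint).neg).congr fun C _ => hF C
  have hF0 : ∀ C, 0 < C → F C ≤ 0 := by
    intro C hC
    rw [hF, neg_nonpos]
    exact setIntegral_nonneg measurableSet_Ioi fun s hs =>
      mul_nonneg (sq_nonneg _) (hC.trans hs).le
  have hFb : ∀ C, C₀ ≤ C → -F C ≤ K ^ 2 / (1 + 2 * α) * C ^ (-1 - 2 * α) := by
    intro C hC
    have hC0 : 0 < C := hC₀.trans_le hC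
    have hp : -2 - 2 * α < -1 := by linarith
    rw [hF, neg_neg]
    calc ∫ s in Ioi C, (u s) ^ 2 * s
        ≤ ∫ s in Ioi C, K ^ 2 * s ^ (-2 - 2 * α) := by
          refine setIntegral_mono_on (hint C hC0)
            ((integrableOn_Ioi_rpow_of_lt hp hC0).const_mul _) measurableSet_Ioi fun s hs => ?_
          have hs0 : 0 < s := hC0.trans hs
          have hsq : (u s) ^ 2 ≤ (K * s ^ (-(3/2 : ℝ) - α)) ^ 2 :=
            sq_le_sq' (neg_le_of_abs_le (hbound s (hC.trans (le_of_lt hs))))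
              (le_of_abs_le (hbound s (hC.trans (le_of_lt hs))))
          refine (mul_le_mul_of_nonneg_right hsq hs0.le).trans_eq ?_
          have hexp : (s ^ (-(3/2 : ℝ) - α)) ^ 2 * s = s ^ (-2 - 2 * α) := by
            rw [sq, ← rpow_add hs0, ← rpow_add_one hs0.ne']
            congr 1
            ring
          rw [mul_pow, mul_assoc, hexp]
      _ = K ^ 2 / (1 + 2 * α) * C ^ (-1 - 2 * α) := by
          rw [integral_const_mul, integral_Ioi_rpow_of_lt hp hC0,
            show -2 - 2 * α + 1 = -1 - 2 * α by ring, show -1 - 2 * α = -(1 + 2 * α) by ring,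
            neg_div_neg_eq]
          ring
  have hec : ContinuousOn (fun s => exp (F s)) (Ioi 0) := continuous_exp.comp_continuousOn hFc
  have he1 : ∀ s, 0 < s → exp (F s) ≤ 1 := fun s hs => exp_le_one_iff.2 (hF0 s hs)
  have hQi : ∀ C, 0 < C → IntegrableOn (fun s => 1 - exp (F s)) (Ioi C) := by
    intro C hC
    refine integrableOn_tail_of_le_rpow (g := fun s => 1 - exp (F s))
      (A := K ^ 2 / (1 + 2 * α)) (B := C₀) (continuousOn_const.sub hec)
      (show -1 - 2 * α < -1 by linarith) (fun s hs => ?_) hC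
    rw [abs_of_nonneg (sub_nonneg.2 (he1 s (hC₀.trans_le hs)))]
    linarith [hFb s hs, add_one_le_exp (F s)]
  have hPi : ∀ C, 0 < C → IntegrableOn (fun s => exp (F s) / s ^ 2) (Ioi C) := by
    intro C hC
    refine integrableOn_tail_of_le_rpow (g := fun s => exp (F s) / s ^ 2)
      (A := 1) (p := -2) (B := 1)
      (hec.div (continuousOn_id.pow 2) fun s hs => pow_ne_zero 2 (ne_of_gt hs))
      (by norm_num) (fun s hs => ?_) hC
    have hs0 : 0 < s := by linarith
    rw [abs_of_nonneg (by positivity), one_mul, rpow_neg hs0.le, rpow_two, div_eq_mul_inv]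
    exact mul_le_of_le_one_left (by positivity) (he1 s hs0)
  have hQc : ContinuousOn Q (Ioi 0) :=
    (continuousOn_id.add (continuousOn_tail_integral hQi)).congr fun C _ => hQ C
  have hPc : ContinuousOn P (Ioi 0) := (continuousOn_tail_integral hPi).congr fun C _ => hP C
  have hWc : ContinuousOn (fun s => Q s - 3 * m + 2 * q ^ 2 * P s) (Ioi 0) :=
    (hQc.sub continuousOn_const).add (continuousOn_const.mul hPc)
  have hsub : Ioi Cs ⊆ Ioi 0 := Ioi_subset_Ioi hCs.le
  have hwc : ContinuousOn (fun s => exp (F s) / s ^ 4) (Ioi 0) :=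
    hec.div (continuousOn_id.pow 4) fun s hs => pow_ne_zero 4 (ne_of_gt hs)
  set I := ∫ t in Ioi Cs, (1 - exp (F t)) with hI
  have hWb : ∀ s, Cs ≤ s →
      |Q s - 3 * m + 2 * q ^ 2 * P s| ≤ s + (I + 3 * |m| + 2 * q ^ 2 * P Cs) := by
    intro s hs
    have h1 := tail_integral_mem_Icc (hQi Cs hCs)
      (fun t ht => sub_nonneg.2 (he1 t (hCs.trans ht))) hs
    have h2 := tail_integral_mem_Icc (hPi Cs hCs) (fun t _ => by positivity) hs
    rw [← hI] at h1
    rw [← hP, ← hP] at h2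
    have h3 := mul_le_mul_of_nonneg_left h2.2 (by positivity : 0 ≤ 2 * q ^ 2)
    have h4 := mul_nonneg (by positivity : 0 ≤ 2 * q ^ 2) h2.1
    rw [hQ, abs_le]
    constructor <;> linarith [h1.1, h1.2, le_abs_self m, neg_abs_le m]
  have hi : IntegrableOn
      (fun s => (Q s - 3 * m + 2 * q ^ 2 * P s) * (exp (F s) / s ^ 4)) (Ioi Cs) := by
    set L := I + 3 * |m| + 2 * q ^ 2 * P Cs
    have hL0 : 0 ≤ L := by
      have h1 := (tail_integral_mem_Icc (hQi Cs hCs)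
        (fun t ht => sub_nonneg.2 (he1 t (hCs.trans ht))) le_rfl).1
      have h2 := (tail_integral_mem_Icc (hPi Cs hCs) (fun t _ => by positivity) le_rfl).1
      rw [← hI] at h1
      rw [← hP] at h2
      positivity
    refine integrableOn_tail_of_le_rpow
      (g := fun s => (Q s - 3 * m + 2 * q ^ 2 * P s) * (exp (F s) / s ^ 4))
      (A := 1 + L) (p := -3) (B := max Cs 1)
      (hWc.mul hwc) (by norm_num) (fun s hs => ?_) hCs
    have hs1 : 1 ≤ s := (le_max_right _ _).trans hs
    have hs0 : 0 < s := by linarith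
    have hw : exp (F s) / s ^ 4 ≤ 1 / s ^ 4 :=
      div_le_div_of_nonneg_right (he1 s hs0) (by positivity)
    rw [abs_mul, abs_of_nonneg (by positivity : 0 ≤ exp (F s) / s ^ 4)]
    calc |Q s - 3 * m + 2 * q ^ 2 * P s| * (exp (F s) / s ^ 4)
        ≤ ((1 + L) * s) * (1 / s ^ 4) := by
          refine mul_le_mul ((hWb s ((le_max_left _ _).trans hs)).trans ?_) hw
            (by positivity) (by positivity)
          nlinarith
      _ = (1 + L) * s ^ (-3 : ℝ) := by
          rw [rpow_neg hs0.le, show (3 : ℝ) = (3 : ℕ) by norm_num, rpow_natCast]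
          field_simp
  refine exists_zero_of_weighted_integral_eq_zero (hWc.mono hsub)
    (fun s hs => div_pos (exp_pos _) (pow_pos (hCs.trans hs) 4)) hi ?_
  simpa only [mul_div_assoc] using hhor
end

section
/- Suppose b > 0 and Q(C)·P(C) = 1 for all C ≥ b. Then Q(C) = C and P(C) = 1/C for all C ≥ b. -/
open MeasureTheory Real Set Filter

theorem hasDerivAt_setIntegral_Ioi {g : ℝ → ℝ} (hg : ContinuousOn g (Ioi 0))
    (hi : ∀ c, 0 < c → IntegrableOn g (Ioi c)) {c : ℝ} (hc : 0 < c) :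
    HasDerivAt (fun x => ∫ s in Ioi x, g s) (-g c) c := by
  have hc2 : 0 < c / 2 := by positivity
  have hII : ∀ x, c / 2 ≤ x → IntervalIntegrable g volume (c / 2) x := fun x hx =>
    (intervalIntegrable_iff_integrableOn_Ioc_of_le hx).2
      ((hi _ hc2).mono_set Ioc_subset_Ioi_self)
  have hderiv : HasDerivAt (fun x => ∫ s in (c / 2)..x, g s) (g c) c :=
    intervalIntegral.integral_hasDerivAt_right (hII c (by linarith))
      (hg.stronglyMeasurableAtFilter isOpen_Ioi c hc) (hg.continuousAt (Ioi_mem_nhds hc))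
  refine (hderiv.const_sub (∫ s in Ioi (c / 2), g s)).congr_of_eventuallyEq ?_
  filter_upwards [Ioi_mem_nhds (show c / 2 < c by linarith)] with x hx
  have hx' : c / 2 < x := hx
  have := intervalIntegral.integral_interval_add_Ioi (hi _ hc2) (hi x (by linarith))
  linarith

theorem stmt_12
    (α : ℝ) (hα : 0 < α)
    (u : ℝ → ℝ) (hu : ContinuousOn u (Set.Ioi 0))
    (K C₀ : ℝ) (hK : 0 < K) (hC₀ : 0 < C₀)
    (hbound : ∀ C, C₀ ≤ C → |u C| ≤ K * C ^ (-(3/2 : ℝ) - α))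
    (hint : ∀ C, 0 < C → MeasureTheory.IntegrableOn (fun s => (u s) ^ 2 * s) (Set.Ioi C))
    (F Q P : ℝ → ℝ)
    (hF : ∀ C, F C = -∫ s in Set.Ioi C, (u s) ^ 2 * s)
    (hQ : ∀ C, Q C = C + ∫ s in Set.Ioi C, (1 - Real.exp (F s)))
    (hP : ∀ C, P C = ∫ s in Set.Ioi C, Real.exp (F s) / s ^ 2)
    (b : ℝ) (hb : 0 < b)
    (hQP : ∀ C, b ≤ C → Q C * P C = 1) :
    ∀ C, b ≤ C → Q C = C ∧ P C = 1 / C := by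
  intro C hC
  have hC0 : 0 < C := hb.trans_le hC
  suffices h : Q C = C from
    ⟨h, by rw [eq_div_iff hC0.ne', mul_comm]; simpa [h] using hQP C hC⟩
  have hFc : ContinuousOn F (Ioi 0) := by
    intro x hx
    rw [funext hF]
    exact (hasDerivAt_setIntegral_Ioi (by fun_prop) hint hx).neg.continuousAt.continuousWithinAt
  have hF0 : ∀ s, 0 < s → F s ≤ 0 := by
    intro s hs
    rw [hF, neg_nonpos]
    exact setIntegral_nonneg measurableSet_Ioi fun x hx =>
      mul_nonneg (sq_nonneg _) (hs.trans hx).le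
  have hec : ContinuousOn (fun s => exp (F s)) (Ioi 0) := hFc.rexp
  have h1c : ContinuousOn (fun s => 1 - exp (F s)) (Ioi 0) := continuousOn_const.sub hec
  -- If the integrand of `Q` is not integrable, its integral is `0` by convention.
  by_cases hI : IntegrableOn (fun s => 1 - exp (F s)) (Ioi C)
  swap
  · rw [hQ, integral_undef hI, add_zero]
  have hI' : ∀ c, 0 < c → IntegrableOn (fun s => 1 - exp (F s)) (Ioi c) := by
    intro c hc
    have hcc : IntegrableOn (fun s => 1 - exp (F s)) (Icc c C) :=
      (h1c.mono fun x hx => hc.trans_le hx.1).integrableOn_Icc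
    refine (hcc.union hI).mono_set fun x hx => ?_
    rcases le_or_gt x C with h | h
    · exact Or.inl ⟨le_of_lt hx, h⟩
    · exact Or.inr h
  have hPc : ContinuousOn (fun s => exp (F s) / s ^ 2) (Ioi 0) :=
    hec.div (by fun_prop) fun x hx => pow_ne_zero 2 (ne_of_gt hx)
  have hPi : ∀ c, 0 < c → IntegrableOn (fun s => exp (F s) / s ^ 2) (Ioi c) := by
    intro c hc
    refine (integrableOn_Ioi_rpow_of_lt (show (-2 : ℝ) < -1 by norm_num) hc).mono'
      ((hPc.mono (Ioi_subset_Ioi hc.le)).aestronglyMeasurable measurableSet_Ioi) ?_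
    filter_upwards [ae_restrict_mem measurableSet_Ioi] with s hs
    have hs0 : 0 < s := hc.trans hs
    rw [norm_of_nonneg (by positivity), rpow_neg hs0.le, rpow_two, ← one_div]
    gcongr
    exact exp_le_one_iff.2 (hF0 s hs0)
  have hQd : HasDerivAt Q (1 + -(1 - exp (F C))) C := by
    rw [funext hQ]
    exact (hasDerivAt_id C).add (hasDerivAt_setIntegral_Ioi h1c hI' hC0)
  have hPd : HasDerivAt P (-(exp (F C) / C ^ 2)) C := by
    rw [funext hP]
    exact hasDerivAt_setIntegral_Ioi hPc hPi hC0
  have hzero : HasDerivWithinAt (fun x => Q x * P x) 0 (Ici C) C :=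
    (hasDerivWithinAt_const C (Ici C) (1 : ℝ)).congr
      (fun x hx => hQP x (hC.trans hx)) (hQP C hC)
  have heq := (uniqueDiffOn_Ici C C self_mem_Ici).eq_deriv _
    (hQd.mul hPd).hasDerivWithinAt hzero
  have hQC : C ≤ Q C := by
    rw [hQ, le_add_iff_nonneg_right]
    exact setIntegral_nonneg measurableSet_Ioi fun x hx =>
      sub_nonneg.2 (exp_le_one_iff.2 (hF0 x (hC0.trans hx)))
  have hmul : exp (F C) * (P C - Q C / C ^ 2) = 0 := by linear_combination heq
  have hPQ : P C = Q C / C ^ 2 :=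
    sub_eq_zero.1 ((mul_eq_zero.1 hmul).resolve_left (exp_pos _).ne')
  have hsq : Q C ^ 2 = C ^ 2 := by
    have := hQP C hC
    rw [hPQ] at this
    field_simp at this
    exact this
  exact (pow_left_inj₀ (hC0.le.trans hQC) hC0.le two_ne_zero).1 hsq
end

section
/- (Extremal black hole formulas.) Suppose m ∈ ℝ, q ∈ ℝ and C* > 0 satisfy both ∫_{C*}^∞ (Q(s) − 3m + 2q²·P(s))·e^{F(s)}/s⁴ ds = 0 and Q(C*) − 3m + 2q²·P(C*) = 0, and suppose X(C*) := P(C*)·∫_{C*}^∞ e^{F(s)}/s⁴ ds − ∫_{C*}^∞ P(s)·e^{F(s)}/s⁴ ds ≠ 0. Then m = (1/(3X(C*)))·(P(C*)·∫_{C*}^∞ Q(s)·e^{F(s)}/s⁴ ds − Q(C*)·∫_{C*}^∞ P(s)·e^{F(s)}/s⁴ ds) and q² = (1/(2X(C*)))·(∫_{C*}^∞ Q(s)·e^{F(s)}/s⁴ ds − Q(C*)·∫_{C*}^∞ e^{F(s)}/s⁴ ds). -/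
open MeasureTheory Real Set Filter

/-- The tail integrals of a nonnegative locally integrable function decrease, also when they
all take the default value `0` because the function is not integrable at infinity. -/
theorem antitoneOn_setIntegral_Ioi {h : ℝ → ℝ} {a : ℝ} (h0 : ∀ s ∈ Ioi a, 0 ≤ h s)
    (hi : ∀ b, IntegrableOn h (Ioc a b)) :
    AntitoneOn (fun s => ∫ t in Ioi s, h t) (Ici a) := by
  intro x hx y hy hxy
  have hx' : a ≤ x := hx
  by_cases H : IntegrableOn h (Ioi x)
  · refine setIntegral_mono_set H ?_ (Ioi_subset_Ioi hxy).eventuallyLE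
    exact (ae_restrict_iff' measurableSet_Ioi).2
      (Eventually.of_forall fun t ht => h0 t (lt_of_le_of_lt hx' ht))
  · have H' : ¬ IntegrableOn h (Ioi y) := by
      intro Hy
      apply H
      rw [← Ioc_union_Ioi_eq_Ioi hxy]
      exact ((hi y).mono_set (Ioc_subset_Ioc_left hx')).union Hy
    exact ((integral_undef H').trans (integral_undef H).symm).le

/-- The tail integrals of a nonnegative function are nonnegative. -/
theorem setIntegral_Ioi_nonneg {h : ℝ → ℝ} {a : ℝ} (h0 : ∀ s ∈ Ioi a, 0 ≤ h s) :
    ∀ s ∈ Ici a, 0 ≤ ∫ t in Ioi s, h t :=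
  fun _ hs => setIntegral_nonneg measurableSet_Ioi fun t ht =>
    h0 t (lt_of_le_of_lt (mem_Ici.1 hs) ht)

/-- A nonnegative antitone factor preserves integrability on a half-line. -/
theorem AntitoneOn.integrableOn_Ioi_mul {f w : ℝ → ℝ} {a : ℝ} (hf : AntitoneOn f (Ici a))
    (h0 : ∀ s ∈ Ici a, 0 ≤ f s) (hw : IntegrableOn w (Ioi a)) :
    IntegrableOn (fun s => f s * w s) (Ioi a) := by
  refine Integrable.bdd_mul (c := f a) hw
    (aemeasurable_restrict_of_antitoneOn measurableSet_Ioi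
      (hf.mono Ioi_subset_Ici_self)).aestronglyMeasurable ?_
  refine (ae_restrict_iff' measurableSet_Ioi).2 (Eventually.of_forall fun s hs => ?_)
  have hs' : s ∈ Ici a := Ioi_subset_Ici_self hs
  rw [Real.norm_of_nonneg (h0 s hs')]
  exact hf self_mem_Ici hs' hs'

theorem integrableOn_Ioi_one_div_pow {a : ℝ} (ha : 0 < a) {n : ℕ} (hn : 1 < n) :
    IntegrableOn (fun s : ℝ => 1 / s ^ n) (Ioi a) := by
  have h := integrableOn_Ioi_rpow_of_lt (a := -(n : ℝ)) (by
    have : (1 : ℝ) < n := by exact_mod_cast hn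
    linarith) ha
  refine h.congr_fun (fun s hs => ?_) measurableSet_Ioi
  have hs0 : 0 < s := ha.trans hs
  simp only [Real.rpow_neg hs0.le, Real.rpow_natCast, one_div]

theorem stmt_15
    (α : ℝ) (hα : 0 < α)
    (u : ℝ → ℝ) (hu : ContinuousOn u (Set.Ioi 0))
    (K C₀ : ℝ) (hK : 0 < K) (hC₀ : 0 < C₀)
    (hbound : ∀ C, C₀ ≤ C → |u C| ≤ K * C ^ (-(3/2 : ℝ) - α))
    (hint : ∀ C, 0 < C → MeasureTheory.IntegrableOn (fun s => (u s) ^ 2 * s) (Set.Ioi C))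
    (F Q P : ℝ → ℝ)
    (hF : ∀ C, F C = -∫ s in Set.Ioi C, (u s) ^ 2 * s)
    (hQ : ∀ C, Q C = C + ∫ s in Set.Ioi C, (1 - Real.exp (F s)))
    (hP : ∀ C, P C = ∫ s in Set.Ioi C, Real.exp (F s) / s ^ 2)
    (m q Cs : ℝ) (hCs : 0 < Cs)
    (hhor : ∫ s in Set.Ioi Cs, (Q s - 3 * m + 2 * q ^ 2 * P s) * Real.exp (F s) / s ^ 4 = 0)
    (hext : Q Cs - 3 * m + 2 * q ^ 2 * P Cs = 0)
    (X : ℝ)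
    (hX : X = P Cs * (∫ s in Set.Ioi Cs, Real.exp (F s) / s ^ 4) -
        ∫ s in Set.Ioi Cs, P s * Real.exp (F s) / s ^ 4)
    (hXne : X ≠ 0) :
    m = 1 / (3 * X) *
        (P Cs * (∫ s in Set.Ioi Cs, Q s * Real.exp (F s) / s ^ 4) -
          Q Cs * (∫ s in Set.Ioi Cs, P s * Real.exp (F s) / s ^ 4)) ∧
      q ^ 2 = 1 / (2 * X) *
        ((∫ s in Set.Ioi Cs, Q s * Real.exp (F s) / s ^ 4) -
          Q Cs * (∫ s in Set.Ioi Cs, Real.exp (F s) / s ^ 4)) := by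
  set G : ℝ → ℝ := fun C => ∫ s in Ioi C, (u s) ^ 2 * s with hG
  have hFG : ∀ s, F s = -G s := hF
  have hu0 : ∀ s ∈ Ioi Cs, 0 ≤ (u s) ^ 2 * s := fun s hs =>
    mul_nonneg (sq_nonneg _) (hCs.trans hs).le
  have hGanti : AntitoneOn G (Ici Cs) :=
    antitoneOn_setIntegral_Ioi hu0 fun b => (hint Cs hCs).mono_set Ioc_subset_Ioi_self
  have hG0 : ∀ s ∈ Ici Cs, 0 ≤ G s := setIntegral_Ioi_nonneg hu0
  have hdef_anti : AntitoneOn (fun s => 1 - Real.exp (F s)) (Ici Cs) := by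
    intro x hx y hy hxy
    have := hGanti hx hy hxy
    have : Real.exp (F x) ≤ Real.exp (F y) :=
      Real.exp_le_exp.2 (by rw [hFG, hFG]; linarith)
    simp only
    linarith
  have hdef0 : ∀ s ∈ Ici Cs, 0 ≤ 1 - Real.exp (F s) := by
    intro s hs
    have : Real.exp (F s) ≤ 1 :=
      Real.exp_le_one_iff.2 (by rw [hFG]; linarith [hG0 s hs])
    linarith
  have hexp : ∀ n : ℕ, 1 < n →
      IntegrableOn (fun s => Real.exp (F s) / s ^ n) (Ioi Cs) := by
    intro n hn
    have hw := integrableOn_Ioi_one_div_pow hCs hn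
    refine (hw.sub (hdef_anti.integrableOn_Ioi_mul hdef0 hw)).congr
      (Eventually.of_forall fun s => ?_)
    simp only [Pi.sub_apply]
    ring
  have hP0 : ∀ s ∈ Ioi Cs, 0 ≤ Real.exp (F s) / s ^ 2 := fun s _ => by positivity
  have hPw : IntegrableOn (fun s => P s * Real.exp (F s) / s ^ 4) (Ioi Cs) := by
    have h := (antitoneOn_setIntegral_Ioi hP0 fun b =>
      (hexp 2 (by norm_num)).mono_set Ioc_subset_Ioi_self).integrableOn_Ioi_mul
      (setIntegral_Ioi_nonneg hP0) (hexp 4 (by norm_num))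
    simpa only [← hP, mul_div_assoc] using h
  have hQw : IntegrableOn (fun s => Q s * Real.exp (F s) / s ^ 4) (Ioi Cs) := by
    have h0 : ∀ s ∈ Ioi Cs, 0 ≤ 1 - Real.exp (F s) := fun s hs =>
      hdef0 s (Ioi_subset_Ici_self hs)
    have h := (antitoneOn_setIntegral_Ioi h0 fun b =>
      ((hdef_anti.mono Icc_subset_Ici_self).integrableOn_isCompact isCompact_Icc).mono_set
        Ioc_subset_Icc_self).integrableOn_Ioi_mul
      (setIntegral_Ioi_nonneg h0) (hexp 4 (by norm_num))
    refine ((hexp 3 (by norm_num)).add h).congr_fun (fun s hs => ?_) measurableSet_Ioi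
    have hs0 : s ≠ 0 := (hCs.trans hs).ne'
    simp only [Pi.add_apply, hQ s]
    field_simp
  have hsplit : (∫ s in Ioi Cs, Q s * Real.exp (F s) / s ^ 4)
      - 3 * m * (∫ s in Ioi Cs, Real.exp (F s) / s ^ 4)
      + 2 * q ^ 2 * (∫ s in Ioi Cs, P s * Real.exp (F s) / s ^ 4) = 0 := by
    have hw := hexp 4 (by norm_num)
    have hsub : IntegrableOn (fun s => Q s * Real.exp (F s) / s ^ 4
        - 3 * m * (Real.exp (F s) / s ^ 4)) (Ioi Cs) := hQw.sub (hw.const_mul _)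
    rw [← hhor, ← integral_const_mul, ← integral_const_mul,
      ← integral_sub hQw (hw.const_mul _),
      ← integral_add hsub (hPw.const_mul _)]
    congr 1
    ext s
    ring
  constructor
  · rw [one_div_mul_eq_div, eq_div_iff (by simpa using hXne), hX]
    linear_combination (-P Cs) * hsplit +
      (∫ s in Ioi Cs, P s * Real.exp (F s) / s ^ 4) * hext
  · rw [one_div_mul_eq_div, eq_div_iff (by simpa using hXne), hX]
    linear_combination (-1) * hsplit +
      (∫ s in Ioi Cs, Real.exp (F s) / s ^ 4) * hext
end

section
/- Define R(a) = 3·a^{5/2}·√((a⁵ + 3a³ − 2a² − 3a + 2)·(2a⁴ + 4a³ − 4a² − 4a + 3)) / (4a⁷ + 6a⁶ − 2a⁵ − 4a⁴ − 5a³ + 2a² + 3a − 1) for a > 1. Then R(a) → 3√2/4 as a → +∞; consequently, for every ε > 0 there exists a > 1 such that R(a) > 3√2/4 − ε. Hence the constant 3√2/4 in the charge-to-mass bound q/m < 3√2/4 is the exact (least) upper bound over the family of charged scalar-hair black holes. -/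
open Real Filter

/-- The leading power `a ^ 7` of the numerator and of the denominator cancels, leaving a function
of `a⁻¹` that is continuous at `0`. -/
theorem charge_to_mass_ratio_eq_inv {a : ℝ} (ha : 0 < a) :
    3 * a ^ ((5:ℝ)/2) *
        Real.sqrt ((a ^ 5 + 3 * a ^ 3 - 2 * a ^ 2 - 3 * a + 2) *
          (2 * a ^ 4 + 4 * a ^ 3 - 4 * a ^ 2 - 4 * a + 3)) /
      (4 * a ^ 7 + 6 * a ^ 6 - 2 * a ^ 5 - 4 * a ^ 4 - 5 * a ^ 3 + 2 * a ^ 2 + 3 * a - 1) =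
    3 * Real.sqrt ((1 + 3 * a⁻¹ ^ 2 - 2 * a⁻¹ ^ 3 - 3 * a⁻¹ ^ 4 + 2 * a⁻¹ ^ 5) *
          (2 + 4 * a⁻¹ - 4 * a⁻¹ ^ 2 - 4 * a⁻¹ ^ 3 + 3 * a⁻¹ ^ 4)) /
      (4 + 6 * a⁻¹ - 2 * a⁻¹ ^ 2 - 4 * a⁻¹ ^ 3 - 5 * a⁻¹ ^ 4 + 2 * a⁻¹ ^ 5 + 3 * a⁻¹ ^ 6
        - a⁻¹ ^ 7) := by
  have h0 : a ≠ 0 := ha.ne'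
  have hpow : a ^ ((5:ℝ)/2) = Real.sqrt (a ^ 5) := by
    rw [Real.sqrt_eq_rpow, ← Real.rpow_natCast, ← Real.rpow_mul ha.le]
    norm_num
  have hnum : a ^ 5 * ((a ^ 5 + 3 * a ^ 3 - 2 * a ^ 2 - 3 * a + 2) *
      (2 * a ^ 4 + 4 * a ^ 3 - 4 * a ^ 2 - 4 * a + 3)) =
      (a ^ 7) ^ 2 * ((1 + 3 * a⁻¹ ^ 2 - 2 * a⁻¹ ^ 3 - 3 * a⁻¹ ^ 4 + 2 * a⁻¹ ^ 5) *
          (2 + 4 * a⁻¹ - 4 * a⁻¹ ^ 2 - 4 * a⁻¹ ^ 3 + 3 * a⁻¹ ^ 4)) := by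
    field_simp
  have hden : 4 * a ^ 7 + 6 * a ^ 6 - 2 * a ^ 5 - 4 * a ^ 4 - 5 * a ^ 3 + 2 * a ^ 2 + 3 * a - 1 =
      a ^ 7 * (4 + 6 * a⁻¹ - 2 * a⁻¹ ^ 2 - 4 * a⁻¹ ^ 3 - 5 * a⁻¹ ^ 4 + 2 * a⁻¹ ^ 5 + 3 * a⁻¹ ^ 6
        - a⁻¹ ^ 7) := by
    field_simp
  rw [hpow, mul_assoc, ← Real.sqrt_mul (by positivity), hnum, Real.sqrt_mul (by positivity),
    Real.sqrt_sq (by positivity), hden, mul_left_comm, mul_div_mul_left _ _ (by positivity)]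

theorem stmt_18
    (R : ℝ → ℝ)
    (hR : ∀ a : ℝ, 1 < a → R a = 3 * a ^ ((5:ℝ)/2) *
        Real.sqrt ((a ^ 5 + 3 * a ^ 3 - 2 * a ^ 2 - 3 * a + 2) *
          (2 * a ^ 4 + 4 * a ^ 3 - 4 * a ^ 2 - 4 * a + 3)) /
      (4 * a ^ 7 + 6 * a ^ 6 - 2 * a ^ 5 - 4 * a ^ 4 - 5 * a ^ 3 + 2 * a ^ 2 + 3 * a - 1)) :
    Filter.Tendsto R Filter.atTop (nhds (3 * Real.sqrt 2 / 4)) ∧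
      ∀ ε : ℝ, 0 < ε → ∃ a : ℝ, 1 < a ∧ 3 * Real.sqrt 2 / 4 - ε < R a := by
  have hlim : Tendsto R atTop (nhds (3 * Real.sqrt 2 / 4)) := by
    have hcont : ContinuousAt (fun x : ℝ =>
        3 * Real.sqrt ((1 + 3 * x ^ 2 - 2 * x ^ 3 - 3 * x ^ 4 + 2 * x ^ 5) *
          (2 + 4 * x - 4 * x ^ 2 - 4 * x ^ 3 + 3 * x ^ 4)) /
        (4 + 6 * x - 2 * x ^ 2 - 4 * x ^ 3 - 5 * x ^ 4 + 2 * x ^ 5 + 3 * x ^ 6 - x ^ 7)) 0 :=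
      ContinuousAt.div (by fun_prop) (by fun_prop) (by norm_num)
    have h := hcont.tendsto.comp (tendsto_inv_atTop_zero (𝕜 := ℝ))
    norm_num at h
    refine h.congr' ?_
    filter_upwards [eventually_gt_atTop 1] with a ha
    rw [hR a ha, charge_to_mass_ratio_eq_inv (zero_lt_one.trans ha)]
    simp
  refine ⟨hlim, fun ε hε => ?_⟩
  exact ((eventually_gt_atTop 1).and (hlim.eventually_const_lt (sub_lt_self _ hε))).exists
end
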